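/- arXiv:2011.14571 — 2 statements merged into one kernel-verified Lean document; each statement's English description precedes it below -/
import Mathlib

section
/- Suppose M, σ, r, l are positive real constants with rσ² < M². Define V(q) = M/r − (σ²/(aM))·((1−q*)/q*)^a·(q/(1−q))^a for q ∈ (0, q*]. Then: (i) a(1+a) = 2rσ²/M²; (ii) V satisfies the differential equation V''(q)/2 + V'(q)/q − rσ²·V(q)/(M²q²(1−q)²) + σ²/(M·q²(1−q)²) = 0 for all q ∈ (0, q*); and (iii) V(q*) = (1−a)M/(2r) = σb/√r. -/
/-- The Gauss error function `erf x = (2/√π) ∫₀ˣ e^{−t²} dt`. -/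
noncomputable def erf (x : ℝ) : ℝ :=
  (2 / Real.sqrt Real.pi) * ∫ t in (0:ℝ)..x, Real.exp (-t ^ 2)

lemma erf_nonneg {x : ℝ} (hx : 0 ≤ x) : 0 ≤ erf x := by
  unfold erf
  exact mul_nonneg (by positivity)
    (intervalIntegral.integral_nonneg hx fun t _ => (Real.exp_pos _).le)

lemma hasDerivAt_odds_rpow (a : ℝ) {q : ℝ} (h0 : 0 < q) (h1 : q < 1) :
    HasDerivAt (fun q : ℝ => (q / (1 - q)) ^ a) (a * (q / (1 - q)) ^ a / (q * (1 - q))) q := by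
  have h1' : 0 < 1 - q := sub_pos.2 h1
  have hy : 0 < q / (1 - q) := div_pos h0 h1'
  have hd : HasDerivAt (fun q : ℝ => q / (1 - q)) (1 / (1 - q) ^ 2) q := by
    refine ((hasDerivAt_id' q).div ((hasDerivAt_id' q).const_sub 1) h1'.ne').congr_deriv ?_
    ring
  refine (hd.rpow_const (p := a) (Or.inl hy.ne')).congr_deriv ?_
  rw [Real.rpow_sub_one hy.ne']
  field_simp

lemma hasDerivAt_odds_rpow_deriv (a : ℝ) {q : ℝ} (h0 : 0 < q) (h1 : q < 1) :
    HasDerivAt (fun q : ℝ => a * (q / (1 - q)) ^ a / (q * (1 - q)))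
      (a * (a - 1 + 2 * q) * (q / (1 - q)) ^ a / (q * (1 - q)) ^ 2) q := by
  have h1' : 0 < 1 - q := sub_pos.2 h1
  refine (((hasDerivAt_odds_rpow a h0 h1).const_mul a).div
    ((hasDerivAt_id' q).mul ((hasDerivAt_id' q).const_sub 1)) (mul_pos h0 h1').ne').congr_deriv ?_
  simp only [Pi.mul_apply]
  field_simp
  ring

/-- In the regime `rσ² < M²`, with `p` and `q*` as in the equilibrium, the
function `V(q) = M/r − (σ²/(aM))((1−q*)/q*)^a (q/(1−q))^a` satisfies: (i) `a(1+a) = 2rσ²/M²`;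
(ii) `V''/2 + V'/q − rσ²V/(M²q²(1−q)²) + σ²/(Mq²(1−q)²) = 0` on `(0,q*)`; and
(iii) `V(q*) = (1−a)M/(2r) = σb/√r`. -/
theorem stmt_9 (M σ r l : ℝ) (hM : 0 < M) (hσ : 0 < σ) (hr : 0 < r) (hl : 0 < l)
    (hreg : r * σ ^ 2 < M ^ 2) (a b c p qstar : ℝ)
    (ha : a = (1 / 2) * (Real.sqrt (1 + 8 * r * σ ^ 2 / M ^ 2) - 1))
    (hb : b = (1 - a) * M / (2 * σ * Real.sqrt r))
    (hc : c = (2 * σ * Real.sqrt r * Real.exp (-b ^ 2)) / (M * Real.sqrt Real.pi) + erf b)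
    (hp : p = c * l * Real.sqrt (Real.pi * r) / (c * l * Real.sqrt (Real.pi * r) + σ))
    (hqs : qstar = p * (c - erf b) / (c - p * erf b))
    (V : ℝ → ℝ)
    (hV : ∀ q, V q = M / r
      - (σ ^ 2 / (a * M)) * ((1 - qstar) / qstar) ^ a * (q / (1 - q)) ^ a) :
    a * (1 + a) = 2 * r * σ ^ 2 / M ^ 2 ∧
    (∀ q ∈ Set.Ioo (0:ℝ) qstar,
      deriv (deriv V) q / 2 + deriv V q / q
        - r * σ ^ 2 * V q / (M ^ 2 * q ^ 2 * (1 - q) ^ 2)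
        + σ ^ 2 / (M * q ^ 2 * (1 - q) ^ 2) = 0) ∧
    V qstar = (1 - a) * M / (2 * r) ∧
    V qstar = σ * b / Real.sqrt r := by
  have hσM : 0 < r * σ ^ 2 / M ^ 2 := by positivity
  have hσM1 : r * σ ^ 2 / M ^ 2 < 1 := (div_lt_one (by positivity)).2 hreg
  have harg : 8 * r * σ ^ 2 / M ^ 2 = 8 * (r * σ ^ 2 / M ^ 2) := by ring
  have hsqrt := Real.sq_sqrt (show 0 ≤ 1 + 8 * r * σ ^ 2 / M ^ 2 by positivity)
  have hsqrt0 := Real.sqrt_nonneg (1 + 8 * r * σ ^ 2 / M ^ 2)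
  have hs : Real.sqrt (1 + 8 * r * σ ^ 2 / M ^ 2) = 2 * a + 1 := by rw [ha]; ring
  rw [hs] at hsqrt hsqrt0
  have hquad : a * (1 + a) = 2 * r * σ ^ 2 / M ^ 2 := by
    have : 2 * r * σ ^ 2 / M ^ 2 = 2 * (r * σ ^ 2 / M ^ 2) := by ring
    linarith
  have ha0 : 0 < a := by nlinarith
  have ha1 : a < 1 := by nlinarith
  have hσsq : σ ^ 2 = a * (1 + a) * M ^ 2 / (2 * r) := by rw [hquad]; field_simp
  have hsr : 0 < Real.sqrt r := Real.sqrt_pos.2 hr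
  have hb0 : 0 < b := by
    rw [hb]
    have : 0 < 1 - a := sub_pos.2 ha1
    positivity
  have he : 0 ≤ erf b := erf_nonneg hb0.le
  have hce : erf b < c := by
    rw [hc]
    have : 0 < (2 * σ * Real.sqrt r * Real.exp (-b ^ 2)) / (M * Real.sqrt Real.pi) := by
      positivity
    linarith
  have hc0 : 0 < c := he.trans_lt hce
  have hk : 0 < c * l * Real.sqrt (Real.pi * r) := by positivity
  have hp0 : 0 < p := by rw [hp]; positivity
  have hp1 : p < 1 := by rw [hp, div_lt_one (by positivity)]; linarith
  have hden : 0 < c - p * erf b := by nlinarith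
  have hq0 : 0 < qstar := by rw [hqs]; exact div_pos (mul_pos hp0 (sub_pos.2 hce)) hden
  have hq1 : qstar < 1 := by rw [hqs, div_lt_one hden]; nlinarith
  have hVq : V qstar = (1 - a) * M / (2 * r) := by
    have h1 : 0 < 1 - qstar := sub_pos.2 hq1
    rw [hV, mul_assoc, ← Real.mul_rpow (by positivity) (by positivity),
      show (1 - qstar) / qstar * (qstar / (1 - qstar)) = 1 by field_simp, Real.one_rpow, hσsq]
    field_simp
    ring
  refine ⟨hquad, ?_, hVq, ?_⟩
  · rintro q ⟨hq, hqlt⟩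
    have hqlt1 : q < 1 := hqlt.trans hq1
    set K := (σ ^ 2 / (a * M)) * ((1 - qstar) / qstar) ^ a with hK
    have hV' : V = fun q => M / r - K * (q / (1 - q)) ^ a := funext hV
    have hd : ∀ x ∈ Set.Ioo (0 : ℝ) 1,
        deriv V x = -(K * (a * (x / (1 - x)) ^ a / (x * (1 - x)))) := by
      rintro x ⟨hx0, hx1⟩
      rw [hV']
      exact (((hasDerivAt_odds_rpow a hx0 hx1).const_mul K).const_sub (M / r)).deriv
    have hdd : deriv (deriv V) q =
        -(K * (a * (a - 1 + 2 * q) * (q / (1 - q)) ^ a / (q * (1 - q)) ^ 2)) := by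
      rw [(Filter.eventuallyEq_of_mem (Ioo_mem_nhds hq hqlt1) hd).deriv_eq]
      exact ((hasDerivAt_odds_rpow_deriv a hq hqlt1).const_mul K).neg.deriv
    rw [hdd, hd q ⟨hq, hqlt1⟩, hV]
    have h1 : 0 < 1 - q := sub_pos.2 hqlt1
    generalize (q / (1 - q)) ^ a = f
    clear_value K
    rw [hσsq]
    field_simp
    ring
  · rw [hVq, hb]
    have hr2 : Real.sqrt r ^ 2 = r := Real.sq_sqrt hr.le
    field_simp
    rw [hr2]
end

section
/- Suppose M, σ, r, l are positive real constants with rσ² < M². Let y : (q*, p) → ℝ be a twice differentiable function satisfying φ(y(q)) = c(p − q)/(p(1 − q)) for all q ∈ (q*, p). Then the second derivative of the map q ↦ q·y(q) is strictly negative on (q*, p); equivalently, d²/dq²((σ/√r)·q·y(q)) = −(1−p)c√π·e^{2y(q)²}·(2p(1−q)e^{−y(q)²} − c√π(1−p)q·y(q))/(2p²(1−q)⁴)·(σ/√r) < 0 for all q ∈ (q*, p). -/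
open Real

theorem hasDerivAt_erf (x : ℝ) : HasDerivAt erf (2 / √π * exp (-x ^ 2)) x := by
  have hcont : Continuous fun t : ℝ => exp (-t ^ 2) := by fun_prop
  exact (intervalIntegral.integral_hasDerivAt_right (hcont.intervalIntegrable _ _)
    (hcont.stronglyMeasurableAtFilter _ _) hcont.continuousAt).const_mul (2 / √π)

theorem erf_strictMono : StrictMono erf :=
  strictMono_of_deriv_pos fun x => by
    rw [(hasDerivAt_erf x).deriv]
    positivity

theorem erf_zero : erf 0 = 0 := by simp [erf]

theorem mul_erf_sub_erf_le {y b : ℝ} (hyb : y ≤ b) :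
    y * (erf b - erf y) ≤ (exp (-y ^ 2) - exp (-b ^ 2)) / √π := by
  have hd (t : ℝ) : HasDerivAt (fun t => -exp (-t ^ 2) / √π - y * erf t)
      (2 / √π * exp (-t ^ 2) * (t - y)) t := by
    have h := (((((hasDerivAt_id t).pow 2).neg.exp).neg.div_const √π).sub
      ((hasDerivAt_erf t).const_mul y))
    refine h.congr_deriv ?_
    simp
    ring
  have hmono : MonotoneOn (fun t => -exp (-t ^ 2) / √π - y * erf t) (Set.Icc y b) := by
    refine monotoneOn_of_deriv_nonneg (convex_Icc y b)
      (fun t _ => (hd t).continuousAt.continuousWithinAt)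
      (fun t _ => (hd t).differentiableAt.differentiableWithinAt) fun t ht => ?_
    rw [interior_Icc] at ht
    rw [(hd t).deriv]
    have : 0 ≤ t - y := sub_nonneg.2 ht.1.le
    positivity
  have h := hmono (Set.left_mem_Icc.2 hyb) (Set.right_mem_Icc.2 hyb) hyb
  simp only at h
  rw [sub_div]
  rw [neg_div, neg_div] at h
  linarith

theorem mul_sub_erf_lt {s b y : ℝ} (hs : 0 < s) (hbs : b * s ≤ 1 / 2) (hyb : y ≤ b) :
    √π * y * (2 * s * exp (-b ^ 2) / √π + erf b - erf y) < 2 * exp (-y ^ 2) := by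
  have hπ : 0 < √π := by positivity
  have h := mul_erf_sub_erf_le hyb
  rw [le_div_iff₀ hπ] at h
  have hys : y * s ≤ 1 / 2 := (mul_le_mul_of_nonneg_right hyb hs.le).trans hbs
  have hmul := mul_le_mul_of_nonneg_right hys (exp_pos (-b ^ 2)).le
  have hexp := exp_pos (-y ^ 2)
  have : √π * y * (2 * s * exp (-b ^ 2) / √π + erf b - erf y)
      = 2 * (y * s * exp (-b ^ 2)) + y * (erf b - erf y) * √π := by
    field_simp
    ring
  linarith

theorem hasDerivAt_of_erf_eq {y : ℝ → ℝ} {c p q : ℝ} (hp : 0 < p) (hq : q < 1)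
    (hy : DifferentiableAt ℝ y q)
    (h : (fun x => erf (y x)) =ᶠ[nhds q] fun x => c * (p - x) / (p * (1 - x))) :
    HasDerivAt y (-(c * √π * (1 - p) / (2 * p)) * exp (y q ^ 2) / (1 - q) ^ 2) q := by
  have hq' : 1 - q ≠ 0 := by linarith
  have hπ : √π ≠ 0 := by positivity
  have h1 := (hasDerivAt_erf (y q)).comp q hy.hasDerivAt
  have h2 := (((hasDerivAt_id q).const_sub p).const_mul c).div
    (((hasDerivAt_id q).const_sub 1).const_mul p) (mul_ne_zero hp.ne' hq')
  have h3 := h1.unique (h2.congr_of_eventuallyEq h)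
  refine hy.hasDerivAt.congr_deriv ?_
  simp only [id, exp_neg] at h3
  have he : exp (y q ^ 2) ≠ 0 := (exp_pos _).ne'
  field_simp at h3 ⊢
  linear_combination h3

theorem hasDerivAt_deriv_id_mul {y : ℝ → ℝ} {K q : ℝ} (hq : q < 1)
    (h : ∀ᶠ x in nhds q, HasDerivAt y (-K * exp (y x ^ 2) / (1 - x) ^ 2) x) :
    HasDerivAt (deriv fun x => x * y x)
      (-(2 * K * exp (2 * y q ^ 2) * ((1 - q) * exp (-y q ^ 2) - K * q * y q) / (1 - q) ^ 4))
      q := by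
  have hq' : 1 - q ≠ 0 := by linarith
  have hy := h.self_of_nhds
  have heq : (deriv fun x => x * y x) =ᶠ[nhds q]
      fun x => y x + x * (-K * exp (y x ^ 2) / (1 - x) ^ 2) := by
    filter_upwards [h] with x hx
    simpa using ((hasDerivAt_id' x).fun_mul hx).deriv
  have hd := hy.add ((hasDerivAt_id q).mul
    ((((hy.pow 2).exp).const_mul (-K)).div (((hasDerivAt_id q).const_sub 1).pow 2)
      (pow_ne_zero 2 hq')))
  refine (hd.congr_of_eventuallyEq heq).congr_deriv ?_
  have h2 : exp (2 * y q ^ 2) = exp (y q ^ 2) ^ 2 := by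
    rw [← exp_nat_mul]
    norm_num
  have he : exp (y q ^ 2) ≠ 0 := (exp_pos _).ne'
  simp [h2, exp_neg]
  field_simp
  ring

/-- In the regime `rσ² < M²`, with `y` twice differentiable on `(q*,p)` and
`φ(y(q)) = c(p−q)/(p(1−q))`, the second derivative of `q ↦ q y(q)` is strictly negative on
`(q*,p)`; equivalently,
`d²/dq²((σ/√r) q y(q)) = −(1−p)c√π e^{2y²}(2p(1−q)e^{−y²} − c√π(1−p)q y)/(2p²(1−q)⁴)·(σ/√r) < 0`. -/
theorem stmt_15 (M σ r l : ℝ) (hM : 0 < M) (hσ : 0 < σ) (hr : 0 < r) (hl : 0 < l)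
    (hreg : r * σ ^ 2 < M ^ 2) (a b c p qstar : ℝ)
    (ha : a = (1 / 2) * (Real.sqrt (1 + 8 * r * σ ^ 2 / M ^ 2) - 1))
    (hb : b = (1 - a) * M / (2 * σ * Real.sqrt r))
    (hc : c = (2 * σ * Real.sqrt r * Real.exp (-b ^ 2)) / (M * Real.sqrt Real.pi) + erf b)
    (hp : p = c * l * Real.sqrt (Real.pi * r) / (c * l * Real.sqrt (Real.pi * r) + σ))
    (hqs : qstar = p * (c - erf b) / (c - p * erf b))
    (y : ℝ → ℝ)
    (hy1 : ∀ q ∈ Set.Ioo qstar p, DifferentiableAt ℝ y q)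
    (hy2 : ∀ q ∈ Set.Ioo qstar p, DifferentiableAt ℝ (deriv y) q)
    (herf : ∀ q ∈ Set.Ioo qstar p, erf (y q) = c * (p - q) / (p * (1 - q))) :
    ∀ q ∈ Set.Ioo qstar p,
      deriv (deriv (fun x => (σ / Real.sqrt r) * (x * y x))) q
        = -((1 - p) * c * Real.sqrt Real.pi * Real.exp (2 * (y q) ^ 2)
            * (2 * p * (1 - q) * Real.exp (-(y q) ^ 2)
              - c * Real.sqrt Real.pi * (1 - p) * q * y q)
            / (2 * p ^ 2 * (1 - q) ^ 4)) * (σ / Real.sqrt r) ∧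
      deriv (deriv (fun x => x * y x)) q < 0 := by
  have hπ : 0 < √π := by positivity
  have hsr : 0 < √r := by positivity
  obtain ⟨s, hs⟩ : ∃ s, s = σ * √r / M := ⟨_, rfl⟩
  have hs0 : 0 < s := by rw [hs]; positivity
  have ha0 : 0 < a := by
    have : (1 : ℝ) < √(1 + 8 * r * σ ^ 2 / M ^ 2) :=
      lt_sqrt_of_sq_lt (by rw [one_pow, lt_add_iff_pos_right]; positivity)
    linarith
  have ha1 : a < 1 := by
    have : √(1 + 8 * r * σ ^ 2 / M ^ 2) < 3 := by
      rw [sqrt_lt' (by norm_num)]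
      have : r * σ ^ 2 / M ^ 2 < 1 := (div_lt_one (by positivity)).2 hreg
      have h8 : 8 * r * σ ^ 2 / M ^ 2 = 8 * (r * σ ^ 2 / M ^ 2) := by ring
      linarith
    linarith
  have hb0 : 0 < b := by
    have := sub_pos.2 ha1
    rw [hb]; positivity
  have hbs : b * s ≤ 1 / 2 := by
    have : b * s = (1 - a) / 2 := by rw [hb, hs]; field_simp
    linarith
  have hcs : c = 2 * s * exp (-b ^ 2) / √π + erf b := by
    rw [hc, hs]; field_simp
  have hB : 0 < erf b := erf_zero ▸ erf_strictMono hb0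
  have hcB : erf b < c := by
    rw [hcs, lt_add_iff_pos_left]; positivity
  have hc0 : 0 < c := hB.trans hcB
  have hp0 : 0 < p := by rw [hp]; positivity
  have hp1 : p < 1 := by
    rw [hp, div_lt_one (by positivity)]; linarith
  have hcpB : 0 < c - p * erf b := by nlinarith
  have hy' : ∀ x ∈ Set.Ioo qstar p,
      HasDerivAt y (-(c * √π * (1 - p) / (2 * p)) * exp (y x ^ 2) / (1 - x) ^ 2) x :=
    fun x hx => hasDerivAt_of_erf_eq hp0 (hx.2.trans hp1) (hy1 x hx)
      (Filter.eventuallyEq_of_mem (isOpen_Ioo.mem_nhds hx) herf)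
  intro q hq
  have hq1 : 0 < 1 - q := by linarith [hq.2]
  have hd := (hasDerivAt_deriv_id_mul (hq.2.trans hp1)
    (Filter.eventually_of_mem (isOpen_Ioo.mem_nhds hq) hy')).deriv
  constructor
  · have : deriv (fun x => σ / √r * (x * y x)) = fun x => σ / √r * deriv (fun x => x * y x) x := by
      funext x
      exact deriv_const_mul_field _
    rw [this, deriv_const_mul_field, hd]
    field_simp
  · have hE := herf q hq
    rw [eq_div_iff (by positivity)] at hE
    have hqs' := hq.1
    rw [hqs, div_lt_iff₀ hcpB] at hqs'
    have hyb : y q < b := by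
      rw [← erf_strictMono.lt_iff_lt]
      refine lt_of_mul_lt_mul_right ?_ (mul_pos hp0 hq1).le
      linarith
    have hkey := mul_sub_erf_lt hs0 hbs hyb.le
    rw [← hcs] at hkey
    have hcpE : 0 < c - p * erf (y q) := by
      nlinarith [erf_strictMono hyb]
    rw [hd]
    have hK : 0 < c * √π * (1 - p) / (2 * p) := by
      have := sub_pos.2 hp1
      positivity
    have hpos : 0 < (1 - q) * exp (-y q ^ 2) - c * √π * (1 - p) / (2 * p) * q * y q := by
      have e1 : (1 - q) * (c - p * erf (y q)) = c * (1 - p) := by linarith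
      have e2 : q * (c - p * erf (y q)) = p * (c - erf (y q)) := by linarith
      have e3 : (1 - q) * exp (-y q ^ 2) - c * √π * (1 - p) / (2 * p) * q * y q
          = c * (1 - p) / (2 * (c - p * erf (y q)))
            * (2 * exp (-y q ^ 2) - √π * y q * (c - erf (y q))) := by
        field_simp
        linear_combination
          2 * p * exp (-y q ^ 2) * e1 - c * √π * (1 - p) * y q * e2
      rw [e3]
      have := sub_pos.2 hp1
      have := sub_pos.2 hkey
      positivity
    rw [neg_lt_zero]
    positivity
end
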